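/- arXiv:2503.00921 — 2 statements merged into one kernel-verified Lean document; each statement's English description precedes it below -/
import Mathlib

section
/- Let X be a topological space equipped with a space continuous scaling T (the map x ↦ T_t x is continuous for every t > 0), and let S be an ideal on X. Then S satisfies condition (B) if and only if S = S_τ for some finite continuous modulus τ : X → [0, ∞), where S_τ = {A ⊆ X : inf_{x∈A} τ(x) > 0}. -/
open MeasureTheory Filter Topology Set
open scoped ENNReal NNReal

noncomputable section

/-- The Baire σ-algebra on a topological space: the smallest σ-algebra making all
continuous real-valued functions measurable. -/
def baire (X : Type*) [TopologicalSpace X] : MeasurableSpace X :=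
  ⨆ f : { g : X → ℝ // Continuous g }, MeasurableSpace.comap f.1 (borel ℝ)

/-- An ideal of subsets: closed under finite unions and under taking subsets. -/
def IsSetIdeal {X : Type*} (S : Set (Set X)) : Prop :=
  (∀ A ∈ S, ∀ B ∈ S, A ∪ B ∈ S) ∧ ∀ A B : Set X, B ∈ S → A ⊆ B → A ∈ S

/-- A scaling: an action of the multiplicative group `(0, ∞)`. -/
def IsScaling {X : Type*} (T : ℝ → X → X) : Prop :=
  (∀ x, T 1 x = x) ∧ ∀ t s : ℝ, 0 < t → 0 < s → ∀ x, T t (T s x) = T (t * s) x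

/-- Joint continuity of the scaling on `(0,∞) × X`. -/
def ContinuousScaling {X : Type*} [TopologicalSpace X] (T : ℝ → X → X) : Prop :=
  ContinuousOn (fun p : ℝ × X => T p.1 p.2) (Set.Ioi (0:ℝ) ×ˢ (Set.univ : Set X))

/-- A functionally open set: `{x | 0 < f x}` for a continuous nonnegative `f`. -/
def FunctionallyOpen {X : Type*} [TopologicalSpace X] (G : Set X) : Prop :=
  ∃ f : X → ℝ, Continuous f ∧ (∀ x, 0 ≤ f x) ∧ G = {x | 0 < f x}

def FunctionallyClosed {X : Type*} [TopologicalSpace X] (F : Set X) : Prop :=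
  FunctionallyOpen Fᶜ

/-- Topological consistency of an ideal. -/
def TopConsistent {X : Type*} [TopologicalSpace X] (S : Set (Set X)) : Prop :=
  (∀ B ∈ S, ∃ F ∈ S, FunctionallyClosed F ∧ B ⊆ F) ∧
    ∀ x ∈ ⋃₀ S, ∃ G ∈ S, FunctionallyOpen G ∧ x ∈ G

/-- Scaling consistency of an ideal. -/
def ScalConsistent {X : Type*} (T : ℝ → X → X) (S : Set (Set X)) : Prop :=
  ∀ B ∈ S, ∀ t : ℝ, 0 < t → T t '' B ∈ S

/-- Membership in `M(S)`: finite on the measurable members of `S` and vanishing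
outside the union set of `S`. -/
def MemM {X : Type*} [MeasurableSpace X] (S : Set (Set X)) (μ : Measure X) : Prop :=
  (∀ B ∈ S, MeasurableSet B → μ B < ⊤) ∧ μ (⋃₀ S)ᶜ = 0

/-- Nontriviality of a measure on an ideal. -/
def NontrivialOn {X : Type*} [MeasurableSpace X] (S : Set (Set X)) (μ : Measure X) : Prop :=
  ∃ B ∈ S, 0 < μ B

/-- A bounded continuous function whose support belongs to the ideal `S`. -/
def TestFun {X : Type*} [TopologicalSpace X] (S : Set (Set X)) (f : X → ℝ) : Prop :=
  Continuous f ∧ (∃ C : ℝ, ∀ x, |f x| ≤ C) ∧ Function.support f ∈ S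

/-- Vague convergence on the ideal `S` of a net of measures along the filter `l`. -/
def VagueTendsto {X : Type*} {ι : Type*} [TopologicalSpace X] [MeasurableSpace X]
    (S : Set (Set X)) (μs : ι → Measure X) (l : Filter ι) (μ : Measure X) : Prop :=
  ∀ f : X → ℝ, TestFun S f →
    Tendsto (fun i => ∫ x, f x ∂(μs i)) l (𝓝 (∫ x, f x ∂μ))

/-- `ν ∈ RV(X, T, S, g, μ)`: the measure `ν` is regularly varying on the ideal `S`
with normalising function `g` and (nontrivial) tail measure `μ`. -/
def MeasureRV {X : Type*} [TopologicalSpace X] [MeasurableSpace X]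
    (T : ℝ → X → X) (S : Set (Set X)) (g : ℝ → ℝ) (ν μ : Measure X) : Prop :=
  Measurable g ∧ (∀ t : ℝ, 0 < t → 0 < g t) ∧ Tendsto g atTop atTop ∧
    MemM S μ ∧ NontrivialOn S μ ∧
    ∀ f : X → ℝ, TestFun S f →
      Tendsto (fun t : ℝ => g t * ∫ x, f (T t⁻¹ x) ∂ν) atTop (𝓝 (∫ x, f x ∂μ))

/-- A finite (real-valued) modulus: a nonnegative homogeneous function. -/
def IsModulus {X : Type*} (T : ℝ → X → X) (τ : X → ℝ) : Prop :=
  (∀ x, 0 ≤ τ x) ∧ ∀ t : ℝ, 0 < t → ∀ x, τ (T t x) = t * τ x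

/-- A `[0,∞]`-valued modulus: a homogeneous function. -/
def IsModulusE {X : Type*} (T : ℝ → X → X) (τ : X → ℝ≥0∞) : Prop :=
  ∀ t : ℝ, 0 < t → ∀ x, τ (T t x) = ENNReal.ofReal t * τ x

/-- The ideal generated by a real-valued modulus. -/
def SIdeal {X : Type*} (τ : X → ℝ) : Set (Set X) :=
  {A | ∃ ε : ℝ, 0 < ε ∧ ∀ x ∈ A, ε ≤ τ x}

/-- The ideal generated by a `[0,∞]`-valued modulus. -/
def SIdealE {X : Type*} (τ : X → ℝ≥0∞) : Set (Set X) :=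
  {A | ∃ ε : ℝ≥0∞, 0 < ε ∧ ∀ x ∈ A, ε ≤ τ x}

/-- Condition (B). -/
def CondB {X : Type*} [TopologicalSpace X] (T : ℝ → X → X) (S : Set (Set X)) : Prop :=
  ∃ V : Set X, FunctionallyOpen V ∧ (∀ t : ℝ, 1 ≤ t → T t '' V ⊆ V) ∧
    (⋂ t ∈ Set.Ioi (1:ℝ), T t '' V) = ∅ ∧
    (∀ n : ℕ, T ((n : ℝ) + 1)⁻¹ '' V ∈ S) ∧
    (∀ A ∈ S, ∃ n : ℕ, A ⊆ T ((n : ℝ) + 1)⁻¹ '' V) ∧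
    ∃ F : Set X, FunctionallyClosed F ∧ V ⊆ F ∧
      ∀ s : ℝ, 0 < s → s < 1 → F ⊆ T s '' V

/-- Condition (B₀): the ideal is generated by a family of finite continuous moduli. -/
def CondB0 {X : Type*} [TopologicalSpace X] (T : ℝ → X → X) (S : Set (Set X)) : Prop :=
  ∃ Tf : Set (X → ℝ), (∀ τ ∈ Tf, Continuous τ ∧ IsModulus T τ) ∧
    ∀ A : Set X, A ∈ S ↔
      ∃ I : Finset (X → ℝ), ↑I ⊆ Tf ∧ ∃ ε : ℝ, 0 < ε ∧ ∀ x ∈ A, ∃ τ' ∈ I, ε ≤ τ' x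

/-- `g ∈ RV_α`: regular variation of index `α` at infinity. -/
def RegVary (g : ℝ → ℝ) (α : ℝ) : Prop :=
  ∀ x : ℝ, 0 < x → Tendsto (fun t => g (x * t) / g t) atTop (𝓝 (x ^ α))

/-- τ-additivity of a (Baire) measure. -/
def TauAdditive {X : Type*} [TopologicalSpace X] [MeasurableSpace X] (μ : Measure X) : Prop :=
  ∀ 𝒢 : Set (Set X), 𝒢.Nonempty → (∀ G ∈ 𝒢, FunctionallyOpen G) →
    DirectedOn (· ⊆ ·) 𝒢 → FunctionallyOpen (⋃₀ 𝒢) →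
    μ (⋃₀ 𝒢) = ⨆ G ∈ 𝒢, μ G

/-- α-homogeneity of a measure: `μ(T_t B) = t^{-α} μ(B)`. -/
def HomogeneousMeasure {X : Type*} [MeasurableSpace X] (T : ℝ → X → X) (α : ℝ)
    (μ : Measure X) : Prop :=
  ∀ t : ℝ, 0 < t → ∀ B : Set X, MeasurableSet B →
    μ (T t '' B) = ENNReal.ofReal (t ^ (-α)) * μ B

/-- Perfect normality: disjoint closed sets are precisely separated. -/
def PerfectlyNormal (X : Type*) [TopologicalSpace X] : Prop :=
  ∀ F₁ F₂ : Set X, IsClosed F₁ → IsClosed F₂ → Disjoint F₁ F₂ →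
    ∃ f : X → ℝ, Continuous f ∧ (∀ x, f x ∈ Set.Icc (0:ℝ) 1) ∧
      F₁ = f ⁻¹' {0} ∧ F₂ = f ⁻¹' {1}

theorem FunctionallyOpen.isOpen {X : Type*} [TopologicalSpace X] {G : Set X}
    (hG : FunctionallyOpen G) : IsOpen G := by
  obtain ⟨f, hf, -, rfl⟩ := hG
  exact isOpen_lt continuous_const hf

theorem FunctionallyClosed.isClosed {X : Type*} [TopologicalSpace X] {F : Set X}
    (hF : FunctionallyClosed F) : IsClosed F :=
  isOpen_compl_iff.mp (FunctionallyOpen.isOpen hF)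

theorem functionallyOpen_setOf_lt {X : Type*} [TopologicalSpace X] {f g : X → ℝ}
    (hf : Continuous f) (hg : Continuous g) : FunctionallyOpen {x | f x < g x} :=
  ⟨fun x => max (g x - f x) 0, (hg.sub hf).max continuous_const, fun _ => le_max_right _ _, by
    ext x
    simp⟩

theorem IsScaling.mem_image_iff {X : Type*} {T : ℝ → X → X} (hT : IsScaling T) {t : ℝ}
    (ht : 0 < t) {A : Set X} {x : X} : x ∈ T t '' A ↔ T t⁻¹ x ∈ A := by
  constructor
  · rintro ⟨y, hy, rfl⟩
    rwa [hT.2 _ _ (inv_pos.mpr ht) ht, inv_mul_cancel₀ ht.ne', hT.1]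
  · intro h
    exact ⟨_, h, by rw [hT.2 _ _ ht (inv_pos.mpr ht), mul_inv_cancel₀ ht.ne', hT.1]⟩

theorem IsModulus.mem_image_iff {X : Type*} {T : ℝ → X → X} (hT : IsScaling T) {τ : X → ℝ}
    (hτ : IsModulus T τ) {t : ℝ} (ht : 0 < t) {x : X} :
    x ∈ T t '' {y | 1 < τ y} ↔ t < τ x := by
  rw [hT.mem_image_iff ht, mem_ofPred_eq, hτ.2 _ (inv_pos.mpr ht), inv_mul_eq_div, one_lt_div ht]

theorem IsModulus.condB_sIdeal {X : Type*} [TopologicalSpace X] {T : ℝ → X → X}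
    (hT : IsScaling T) {τ : X → ℝ} (hτ : IsModulus T τ) (hc : Continuous τ) :
    CondB T (SIdeal τ) := by
  have hpos : ∀ n : ℕ, 0 < ((n : ℝ) + 1)⁻¹ := fun n => by positivity
  refine ⟨{x | 1 < τ x}, functionallyOpen_setOf_lt continuous_const hc, fun t ht x hx => ?_, ?_,
    fun n => ⟨_, hpos n, fun x hx => ((hτ.mem_image_iff hT (hpos n)).mp hx).le⟩, ?_,
    {x | 1 ≤ τ x}, ?_, fun x (hx : 1 < τ x) => hx.le, fun s hs hs1 x hx => ?_⟩
  · exact ht.trans_lt ((hτ.mem_image_iff hT (zero_lt_one.trans_le ht)).mp hx)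
  · refine eq_empty_of_forall_notMem fun x hx => ?_
    have h1 : 1 < τ x + 2 := by linarith [hτ.1 x]
    have h2 := (hτ.mem_image_iff hT (zero_lt_one.trans h1)).mp (mem_iInter₂.mp hx _ h1)
    linarith
  · rintro A ⟨ε, hε, hA⟩
    obtain ⟨n, hn⟩ := exists_nat_one_div_lt hε
    rw [one_div] at hn
    exact ⟨n, fun x hx => (hτ.mem_image_iff hT (hpos n)).mpr (hn.trans_le (hA x hx))⟩
  · have : {x | 1 ≤ τ x}ᶜ = {x | τ x < 1} := by
      ext x
      simp
    rw [FunctionallyClosed, this]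
    exact functionallyOpen_setOf_lt hc continuous_const
  · exact (hτ.mem_image_iff hT hs).mpr (hs1.trans_le hx)

/-- The gauge of a set `V` with respect to a scaling: `sup {t > 0 | x ∈ T_t V}`. -/
def scalingGauge {X : Type*} (T : ℝ → X → X) (V : Set X) (x : X) : ℝ :=
  sSup {t : ℝ | 0 < t ∧ T t⁻¹ x ∈ V}

section scalingGauge

variable {X : Type*} {T : ℝ → X → X} {V : Set X}

theorem scalingGauge_nonneg (x : X) : 0 ≤ scalingGauge T V x :=
  Real.sSup_nonneg fun _ ht => ht.1.le

theorem mem_of_le_of_semicone (hT : IsScaling T) (hV : ∀ t : ℝ, 1 ≤ t → T t '' V ⊆ V)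
    {s t : ℝ} (hs : 0 < s) (hst : s ≤ t) {x : X} (hx : T t⁻¹ x ∈ V) : T s⁻¹ x ∈ V := by
  have ht := hs.trans_le hst
  have h := hV (t / s) ((one_le_div hs).mpr hst) (mem_image_of_mem _ hx)
  rw [hT.2 _ _ (div_pos ht hs) (inv_pos.mpr ht)] at h
  rwa [show t / s * t⁻¹ = s⁻¹ by field_simp] at h

theorem bddAbove_of_iInter_eq_empty (hT : IsScaling T) (hV : ∀ t : ℝ, 1 ≤ t → T t '' V ⊆ V)
    (hI : (⋂ t ∈ Set.Ioi (1 : ℝ), T t '' V) = ∅) (x : X) :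
    BddAbove {t : ℝ | 0 < t ∧ T t⁻¹ x ∈ V} := by
  have hx : x ∉ ⋂ t ∈ Set.Ioi (1 : ℝ), T t '' V := hI ▸ notMem_empty x
  simp only [mem_iInter, not_forall] at hx
  obtain ⟨t, ht, hxt⟩ := hx
  have ht0 : 0 < t := zero_lt_one.trans ht
  rw [hT.mem_image_iff ht0] at hxt
  refine ⟨t, fun s hs => ?_⟩
  by_contra! hlt
  exact hxt (mem_of_le_of_semicone hT hV ht0 hlt.le hs.2)

theorem lt_scalingGauge_iff (hT : IsScaling T) (hV : ∀ t : ℝ, 1 ≤ t → T t '' V ⊆ V)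
    (hI : (⋂ t ∈ Set.Ioi (1 : ℝ), T t '' V) = ∅) {t : ℝ} (ht : 0 ≤ t) {x : X} :
    t < scalingGauge T V x ↔ ∃ s, t < s ∧ T s⁻¹ x ∈ V := by
  constructor
  · intro h
    have hne : {t : ℝ | 0 < t ∧ T t⁻¹ x ∈ V}.Nonempty := by
      by_contra hne
      rw [scalingGauge, not_nonempty_iff_eq_empty.mp hne, Real.sSup_empty] at h
      exact h.not_ge ht
    obtain ⟨s, hs, hts⟩ := exists_lt_of_lt_csSup hne h
    exact ⟨s, hts, hs.2⟩
  · rintro ⟨s, hts, hs⟩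
    exact hts.trans_le
      (le_csSup (bddAbove_of_iInter_eq_empty hT hV hI x) ⟨ht.trans_lt hts, hs⟩)

theorem isModulus_scalingGauge (hT : IsScaling T) : IsModulus T (scalingGauge T V) := by
  refine ⟨scalingGauge_nonneg, fun c hc x => ?_⟩
  rw [scalingGauge, scalingGauge, ← smul_eq_mul, ← Real.sSup_smul_of_nonneg hc.le]
  congr 1
  ext t
  rw [mem_smul_set_iff_inv_smul_mem₀ hc.ne', smul_eq_mul, mem_ofPred_eq, mem_ofPred_eq,
    mul_pos_iff_of_pos_left (inv_pos.mpr hc)]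
  refine and_congr_right fun ht => ?_
  rw [hT.2 _ _ (inv_pos.mpr ht) hc, mul_inv, inv_inv, mul_comm]

theorem continuous_scalingGauge [TopologicalSpace X] (hT : IsScaling T)
    (hTsc : ∀ t : ℝ, 0 < t → Continuous (T t)) (hVo : IsOpen V)
    (hV : ∀ t : ℝ, 1 ≤ t → T t '' V ⊆ V)
    (hI : (⋂ t ∈ Set.Ioi (1 : ℝ), T t '' V) = ∅) {F : Set X} (hF : IsClosed F) (hVF : V ⊆ F)
    (hFV : ∀ s : ℝ, 0 < s → s < 1 → F ⊆ T s '' V) :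
    Continuous (scalingGauge T V) := by
  have hlt := fun {t : ℝ} (ht : 0 ≤ t) (x : X) => lt_scalingGauge_iff hT hV hI ht (x := x)
  refine OrderTopology.continuous_iff.mpr fun a => ⟨?_, ?_⟩
  · rcases lt_or_ge a 0 with ha | ha
    · convert isOpen_univ
      exact eq_univ_of_forall fun x => ha.trans_le (scalingGauge_nonneg x)
    · have : scalingGauge T V ⁻¹' Ioi a = ⋃ s ∈ Ioi a, T s⁻¹ ⁻¹' V := by
        ext x
        simp [hlt ha]
      rw [this]
      exact isOpen_biUnion fun s hs => hVo.preimage (hTsc _ (inv_pos.mpr (ha.trans_lt hs)))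
  · rcases le_or_gt a 0 with ha | ha
    · convert isOpen_empty
      exact eq_empty_of_forall_notMem fun x hx =>
        (ha.trans (scalingGauge_nonneg x)).not_gt hx
    · have : scalingGauge T V ⁻¹' Iio a = ⋃ s ∈ Ioo 0 a, T s⁻¹ ⁻¹' Fᶜ := by
        ext x
        simp only [mem_preimage, mem_Iio, mem_iUnion, mem_compl_iff, exists_prop]
        constructor
        · intro h
          obtain ⟨s, h1, h2⟩ := exists_between h
          obtain ⟨r, h3, h4⟩ := exists_between h1
          have hr0 : 0 < r := (scalingGauge_nonneg x).trans_lt h3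
          have hs0 := hr0.trans h4
          refine ⟨s, ⟨hs0, h2⟩, fun hsF => h3.not_ge ?_⟩
          have := hFV (r / s) (div_pos hr0 hs0) ((div_lt_one hs0).mpr h4) hsF
          rw [hT.mem_image_iff (div_pos hr0 hs0),
            hT.2 _ _ (inv_pos.mpr (div_pos hr0 hs0)) (inv_pos.mpr hs0),
            show (r / s)⁻¹ * s⁻¹ = r⁻¹ by field_simp] at this
          exact le_csSup (bddAbove_of_iInter_eq_empty hT hV hI x) ⟨hr0, this⟩
        · rintro ⟨s, ⟨hs0, hsa⟩, hs⟩
          refine lt_of_le_of_lt ?_ hsa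
          by_contra! h
          obtain ⟨r, hr, hrV⟩ := (hlt hs0.le x).mp h
          exact hs (hVF (mem_of_le_of_semicone hT hV hs0 hr.le hrV))
      rw [this]
      exact isOpen_biUnion fun s hs =>
        hF.isOpen_compl.preimage (hTsc _ (inv_pos.mpr hs.1))

end scalingGauge

/-- condition (B) holds iff the ideal is generated by a finite
continuous modulus. -/
theorem statement15 {X : Type*} [TopologicalSpace X]
    (T : ℝ → X → X) (hT : IsScaling T)
    (hTsc : ∀ t : ℝ, 0 < t → Continuous (T t))
    (S : Set (Set X)) (hS : IsSetIdeal S) :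
    CondB T S ↔ ∃ τ : X → ℝ, Continuous τ ∧ IsModulus T τ ∧ S = SIdeal τ := by
  constructor
  · rintro ⟨V, hVo, hV, hI, hmem, hbase, F, hF, hVF, hFV⟩
    have hpos : ∀ n : ℕ, 0 < ((n : ℝ) + 1)⁻¹ := fun n => by positivity
    refine ⟨scalingGauge T V,
      continuous_scalingGauge hT hTsc hVo.isOpen hV hI hF.isClosed hVF hFV,
      isModulus_scalingGauge hT, Set.ext fun A => ⟨fun hA => ?_, ?_⟩⟩
    · obtain ⟨n, hn⟩ := hbase A hA
      exact ⟨_, hpos n, fun x hx => le_csSup (bddAbove_of_iInter_eq_empty hT hV hI x)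
        ⟨hpos n, (hT.mem_image_iff (hpos n)).mp (hn hx)⟩⟩
    · rintro ⟨ε, hε, hA⟩
      obtain ⟨n, hn⟩ := exists_nat_one_div_lt hε
      rw [one_div] at hn
      refine hS.2 _ _ (hmem n) fun x hx => (hT.mem_image_iff (hpos n)).mpr ?_
      obtain ⟨s, hs, hsV⟩ :=
        (lt_scalingGauge_iff hT hV hI (hpos n).le).mp (hn.trans_le (hA x hx))
      exact mem_of_le_of_semicone hT hV (hpos n) hs.le hsV
  · rintro ⟨τ, hc, hτ, rfl⟩
    exact hτ.condB_sIdeal hT hc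
end
end

section
/- Let (X, d) be a metric space and let S be an ideal on X such that for every A ∈ S there exists r > 0 with the envelope A^r = {x : d(x, A) ≤ r} belonging to S. Let (μ_γ) be a net in M(S) and μ ∈ M(S). Then μ_γ → μ vaguely on S if and only if ∫ f dμ_γ → ∫ f dμ for every bounded 1-Lipschitz function f : X → ℝ whose support {f ≠ 0} belongs to S. -/
open MeasureTheory Filter Topology Set
open scoped ENNReal NNReal

noncomputable section

/-- The largest `K`-Lipschitz minorant of `f`. -/
def lipschitzMinorant {X : Type*} [PseudoMetricSpace X] (f : X → ℝ) (K : ℝ≥0) (x : X) : ℝ :=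
  ⨅ y, f y + K * dist x y

section LipschitzMinorant

variable {X : Type*} [PseudoMetricSpace X] {f : X → ℝ}

theorem lipschitzMinorant_bddBelow (hf : ∀ x, 0 ≤ f x) (K : ℝ≥0) (x : X) :
    BddBelow (range fun y => f y + K * dist x y) :=
  ⟨0, by rintro _ ⟨y, rfl⟩; have := hf y; positivity⟩

theorem lipschitzMinorant_nonneg (hf : ∀ x, 0 ≤ f x) (K : ℝ≥0) (x : X) :
    0 ≤ lipschitzMinorant f K x :=
  Real.iInf_nonneg fun y => by have := hf y; positivity

theorem lipschitzMinorant_le (hf : ∀ x, 0 ≤ f x) (K : ℝ≥0) (x : X) :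
    lipschitzMinorant f K x ≤ f x :=
  (ciInf_le (lipschitzMinorant_bddBelow hf K x) x).trans (by simp)

theorem lipschitzWith_lipschitzMinorant (hf : ∀ x, 0 ≤ f x) (K : ℝ≥0) :
    LipschitzWith K (lipschitzMinorant f K) := by
  refine LipschitzWith.of_le_add_mul K fun x y => ?_
  have : Nonempty X := ⟨x⟩
  rw [← sub_le_iff_le_add]
  refine le_ciInf fun z => ?_
  have h := ciInf_le (lipschitzMinorant_bddBelow hf K x) z
  have h' := mul_le_mul_of_nonneg_left (dist_triangle x y z) K.2
  simp only [NNReal.val_eq_coe] at h'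
  unfold lipschitzMinorant
  linarith

theorem tendsto_lipschitzMinorant (hf : ∀ x, 0 ≤ f x) (hc : Continuous f) (x : X) :
    Tendsto (fun n : ℕ => lipschitzMinorant f n x) atTop (𝓝 (f x)) := by
  have : Nonempty X := ⟨x⟩
  refine tendsto_order.2 ⟨fun a ha => ?_, fun a ha =>
    Eventually.of_forall fun n => (lipschitzMinorant_le hf n x).trans_lt ha⟩
  obtain ⟨b, hab, hb⟩ := exists_between ha
  obtain ⟨δ, hδ, hball⟩ := Metric.eventually_nhds_iff.1 (hc.continuousAt.eventually_const_lt hb)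
  filter_upwards [(tendsto_natCast_atTop_atTop (R := ℝ)).eventually_ge_atTop (b / δ)] with n hn
  refine hab.trans_le (le_ciInf fun y => ?_)
  simp only [NNReal.coe_natCast]
  rcases lt_or_ge (dist x y) δ with h | h
  · have h1 := hball (by rwa [dist_comm] : dist y x < δ)
    have : 0 ≤ (n : ℝ) * dist x y := by positivity
    linarith
  · have h1 : b ≤ n * δ := (div_le_iff₀ hδ).1 hn
    have h2 : (n : ℝ) * δ ≤ n * dist x y := by gcongr
    have := hf y
    linarith

end LipschitzMinorant

theorem IsSetIdeal.mono {X : Type*} {S : Set (Set X)} (hS : IsSetIdeal S) {A B : Set X}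
    (hB : B ∈ S) (h : A ⊆ B) : A ∈ S :=
  hS.2 A B hB h

theorem TestFun.integrable {X : Type*} [TopologicalSpace X] [MeasurableSpace X]
    [OpensMeasurableSpace X] {S : Set (Set X)} {f : X → ℝ} (hf : TestFun S f)
    {μ : Measure X} (hμ : MemM S μ) : Integrable f μ := by
  obtain ⟨hc, ⟨C, hC⟩, hs⟩ := hf
  rw [← integrableOn_iff_integrable_of_support_subset subset_rfl]
  exact IntegrableOn.of_bound (hμ.1 _ hs hc.isOpen_support.measurableSet)
    hc.measurable.aestronglyMeasurable C (Eventually.of_forall hC)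

theorem tendsto_integral_of_lipschitzWith {X Γ : Type*} [PseudoMetricSpace X]
    [MeasurableSpace X] {S : Set (Set X)} (hS : IsSetIdeal S)
    {μs : Γ → Measure X} {l : Filter Γ} {μ : Measure X}
    (h : ∀ f : X → ℝ, LipschitzWith 1 f → (∃ C : ℝ, ∀ x, |f x| ≤ C) →
      Function.support f ∈ S → Tendsto (fun γ => ∫ x, f x ∂(μs γ)) l (𝓝 (∫ x, f x ∂μ)))
    {f : X → ℝ} {K : ℝ≥0} (hf : LipschitzWith K f) (hb : ∃ C : ℝ, ∀ x, |f x| ≤ C)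
    (hs : Function.support f ∈ S) :
    Tendsto (fun γ => ∫ x, f x ∂(μs γ)) l (𝓝 (∫ x, f x ∂μ)) := by
  obtain ⟨C, hC⟩ := hb
  have hK : (0 : ℝ) < K + 1 := by positivity
  have key := h (fun x => ((K : ℝ) + 1)⁻¹ * f x) (LipschitzWith.of_dist_le_mul fun x y => ?_)
    ⟨((K : ℝ) + 1)⁻¹ * C, fun x => ?_⟩ (hS.mono hs fun x hx => right_ne_zero_of_mul hx)
  · simpa [integral_const_mul, hK.ne'] using key.const_mul ((K : ℝ) + 1)
  · rw [Real.dist_eq, ← mul_sub, abs_mul, abs_of_pos (inv_pos.2 hK), ← Real.dist_eq,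
      inv_mul_le_iff₀ hK]
    have := hf.dist_le_mul x y
    simp only [NNReal.coe_one]
    linarith [dist_nonneg (x := x) (y := y)]
  · rw [abs_mul, abs_of_pos (inv_pos.2 hK)]
    gcongr
    exact hC x

/-- Convergence against Lipschitz functions gives lower semicontinuity of the integral of
nonnegative test functions. -/
theorem TestFun.eventually_lt_integral {X Γ : Type*} [PseudoMetricSpace X]
    [MeasurableSpace X] [OpensMeasurableSpace X] {S : Set (Set X)} (hS : IsSetIdeal S)
    {μs : Γ → Measure X} (hμs : ∀ γ, MemM S (μs γ)) {l : Filter Γ}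
    {μ : Measure X} (hμ : MemM S μ)
    (h : ∀ (f : X → ℝ) (K : ℝ≥0), LipschitzWith K f → (∃ C : ℝ, ∀ x, |f x| ≤ C) →
      Function.support f ∈ S → Tendsto (fun γ => ∫ x, f x ∂(μs γ)) l (𝓝 (∫ x, f x ∂μ)))
    {f : X → ℝ} (hf : TestFun S f) (h0 : ∀ x, 0 ≤ f x) {a : ℝ} (ha : a < ∫ x, f x ∂μ) :
    ∀ᶠ γ in l, a < ∫ x, f x ∂(μs γ) := by
  have htest (n : ℕ) : TestFun S (lipschitzMinorant f n) := by
    obtain ⟨-, ⟨C, hC⟩, hs⟩ := hf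
    refine ⟨(lipschitzWith_lipschitzMinorant h0 n).continuous, ⟨C, fun x => ?_⟩,
      hS.mono hs fun x hx hfx => hx ?_⟩
    · rw [abs_of_nonneg (lipschitzMinorant_nonneg h0 n x)]
      exact (lipschitzMinorant_le h0 n x).trans ((le_abs_self _).trans (hC x))
    · exact le_antisymm (hfx ▸ lipschitzMinorant_le h0 n x) (lipschitzMinorant_nonneg h0 n x)
  have hlim : Tendsto (fun n : ℕ => ∫ x, lipschitzMinorant f n x ∂μ) atTop (𝓝 (∫ x, f x ∂μ)) :=
    tendsto_integral_of_dominated_convergence f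
      (fun n => ((htest n).integrable hμ).aestronglyMeasurable) (hf.integrable hμ)
      (fun n => Eventually.of_forall fun x => by
        rw [Real.norm_eq_abs, abs_of_nonneg (lipschitzMinorant_nonneg h0 n x)]
        exact lipschitzMinorant_le h0 n x)
      (Eventually.of_forall fun x => tendsto_lipschitzMinorant h0 hf.1 x)
  obtain ⟨n, hn⟩ := (hlim.eventually_const_lt ha).exists
  filter_upwards [(h _ _ (lipschitzWith_lipschitzMinorant h0 n) (htest n).2.1
    (htest n).2.2).eventually_const_lt hn] with γ hγ
  exact hγ.trans_le (integral_mono ((htest n).integrable (hμs γ)) (hf.integrable (hμs γ))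
    fun x => lipschitzMinorant_le h0 n x)

/-- A set whose closed `r`-thickening lies in the ideal has a Lipschitz bump function with
support in the ideal. -/
theorem exists_lipschitz_bump {X : Type*} [PseudoMetricSpace X] {S : Set (Set X)}
    (hS : IsSetIdeal S) {A : Set X} {r : ℝ} (hr : 0 < r) (hA : Metric.cthickening r A ∈ S) :
    ∃ (K : ℝ≥0) (φ : X → ℝ), LipschitzWith K φ ∧ (∀ x, 0 ≤ φ x ∧ φ x ≤ 1) ∧
      (∀ x ∈ A, φ x = 1) ∧ Function.support φ ∈ S := by
  refine ⟨_, fun x => (thickenedIndicator hr A x : ℝ),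
    NNReal.isometry_coe.lipschitz.comp (lipschitzWith_thickenedIndicator hr A),
    fun x => ⟨NNReal.coe_nonneg _, mod_cast thickenedIndicator_le_one hr A x⟩,
    fun x hx => by simp [thickenedIndicator_one hr A hx],
    hS.mono hA fun x hx => Metric.thickening_subset_cthickening r A ?_⟩
  by_contra hxA
  exact hx (by simp [thickenedIndicator_zero hr A hxA])

theorem TestFun.add {X : Type*} [TopologicalSpace X] {S : Set (Set X)} (hS : IsSetIdeal S)
    {f g : X → ℝ} (hf : TestFun S f) (hg : TestFun S g) : TestFun S (fun x => f x + g x) := by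
  obtain ⟨hfc, ⟨C, hC⟩, hfs⟩ := hf
  obtain ⟨hgc, ⟨D, hD⟩, hgs⟩ := hg
  exact ⟨hfc.add hgc, ⟨C + D, fun x => (abs_add_le _ _).trans (add_le_add (hC x) (hD x))⟩,
    hS.mono (hS.1 _ hfs _ hgs) (Function.support_add f g)⟩

theorem TestFun.const_mul {X : Type*} [TopologicalSpace X] {S : Set (Set X)}
    (hS : IsSetIdeal S) {f : X → ℝ} (hf : TestFun S f) (c : ℝ) :
    TestFun S (fun x => c * f x) := by
  obtain ⟨hfc, ⟨C, hC⟩, hfs⟩ := hf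
  refine ⟨hfc.const_mul c, ⟨|c| * C, fun x => ?_⟩,
    hS.mono hfs fun x hx => right_ne_zero_of_mul hx⟩
  rw [abs_mul]
  gcongr
  exact hC x

/-- Lipschitz functions determine vague convergence. -/
theorem statement16 {X : Type*} [MetricSpace X] [MeasurableSpace X] [BorelSpace X]
    (S : Set (Set X)) (hS : IsSetIdeal S)
    (henv : ∀ A ∈ S, ∃ r : ℝ, 0 < r ∧ Metric.cthickening r A ∈ S)
    {Γ : Type*} [Nonempty Γ] [Preorder Γ] [IsDirected Γ (· ≤ ·)]
    (μs : Γ → Measure X) (hμs : ∀ γ, MemM S (μs γ))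
    (μ : Measure X) (hμ : MemM S μ) :
    VagueTendsto S μs atTop μ ↔
      ∀ f : X → ℝ, LipschitzWith 1 f → (∃ C : ℝ, ∀ x, |f x| ≤ C) →
        Function.support f ∈ S →
        Tendsto (fun γ => ∫ x, f x ∂(μs γ)) atTop (𝓝 (∫ x, f x ∂μ)) := by
  refine ⟨fun h f hf hb hs => h f ⟨hf.continuous, hb, hs⟩, fun h f hf => ?_⟩
  have hL (g : X → ℝ) (K : ℝ≥0) (hg : LipschitzWith K g) (hb : ∃ C : ℝ, ∀ x, |g x| ≤ C)
      (hs : Function.support g ∈ S) :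
      Tendsto (fun γ => ∫ x, g x ∂(μs γ)) atTop (𝓝 (∫ x, g x ∂μ)) :=
    tendsto_integral_of_lipschitzWith hS h hg hb hs
  obtain ⟨C, hC⟩ := hf.2.1
  obtain ⟨r, hr, hA⟩ := henv _ hf.2.2
  obtain ⟨K, φ, hφ, hφ01, hφ1, hφs⟩ := exists_lipschitz_bump hS hr hA
  have hφb : ∃ D : ℝ, ∀ x, |φ x| ≤ D :=
    ⟨1, fun x => abs_le.2 ⟨by linarith [(hφ01 x).1], (hφ01 x).2⟩⟩
  have hφt : TestFun S φ := ⟨hφ.continuous, hφb, hφs⟩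
  have hle (x : X) : |f x| ≤ C * φ x := by
    by_cases hx : f x = 0
    · rw [hx, abs_zero]
      exact mul_nonneg ((abs_nonneg _).trans (hC x)) (hφ01 x).1
    · rw [hφ1 x hx, mul_one]
      exact hC x
  have hlim := (hL φ K hφ hφb hφs).const_mul C
  -- lower bounds for `C φ + f` and `C φ - f` give both bounds for `f`
  have hlow (c : ℝ) (hc : |c| = 1) (ε : ℝ) (hε : 0 < ε) :
      ∀ᶠ γ in atTop, C * ∫ x, φ x ∂μ + c * ∫ x, f x ∂μ - ε
        < C * ∫ x, φ x ∂(μs γ) + c * ∫ x, f x ∂(μs γ) := by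
    have hint {ν : Measure X} (hν : MemM S ν) :
        ∫ x, (C * φ x + c * f x) ∂ν = C * ∫ x, φ x ∂ν + c * ∫ x, f x ∂ν := by
      rw [integral_add ((hφt.integrable hν).const_mul C) ((hf.integrable hν).const_mul c),
        integral_const_mul, integral_const_mul]
    have key := TestFun.eventually_lt_integral hS hμs hμ hL
      ((hφt.const_mul hS C).add hS (hf.const_mul hS c)) (fun x => ?_)
      (sub_lt_self (∫ x, (C * φ x + c * f x) ∂μ) hε)
    · simpa only [hint hμ, hint (hμs _)] using key
    · have : |c * f x| ≤ C * φ x := by rw [abs_mul, hc, one_mul]; exact hle x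
      linarith [neg_abs_le (c * f x)]
  refine Metric.tendsto_nhds.2 fun ε hε => ?_
  filter_upwards [hlow 1 (by simp) (ε / 2) (half_pos hε), hlow (-1) (by simp) (ε / 2) (half_pos hε),
    Metric.tendsto_nhds.1 hlim (ε / 2) (half_pos hε)] with γ h₁ h₂ h₃
  rw [Real.dist_eq, abs_lt] at h₃ ⊢
  constructor <;> linarith [h₃.1, h₃.2]
end
end
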